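/- Let Z be a non-empty Noetherian topological space, Φ : Z → Z a continuous map, and x ∈ Z a point such that for every n ∈ ℕ the closure of {Φ^i(x) : i ≥ n} equals Z. Let r be the number of irreducible components of Z. Then the irreducible components of Z can be enumerated as Z_0, Z_1, …, Z_{r−1} so that x ∈ Z_0 and Φ(Z_i) ⊆ Z_{(i+1) mod r} for all 0 ≤ i ≤ r−1; moreover, for each i, the closure of {Φ^{rn + i}(x) : n ∈ ℕ} equals Z_i. -/

import Mathlib

/-- The irreducible components of a closed subset `Z` of a topological space: the maximal
closed irreducible subsets of `Z`. Applied to `Z = Set.univ`, these are the irreducible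
components of the whole space. -/
def irrComps {U : Type*} [TopologicalSpace U] (Z : Set U) : Set (Set U) :=
  {C : Set U | Maximal (fun S => S ⊆ Z ∧ IsIrreducible S ∧ IsClosed S) C}

theorem IsIrreducible.exists_subset_of_subset_biUnion {X ι : Type*} [TopologicalSpace X]
    {s : Set X} (hs : IsIrreducible s) {T : Set ι} (hT : T.Finite) {f : ι → Set X}
    (hf : ∀ i ∈ T, IsClosed (f i)) (h : s ⊆ ⋃ i ∈ T, f i) : ∃ i ∈ T, s ⊆ f i := by
  have hfin : (f '' T).Finite := hT.image f
  obtain ⟨z, hz, hsz⟩ := isIrreducible_iff_sUnion_isClosed.1 hs hfin.toFinset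
    (by simpa using hf) (by simpa using h)
  obtain ⟨i, hi, rfl⟩ := hfin.mem_toFinset.1 hz
  exact ⟨i, hi, hsz⟩

theorem irrComps_univ_eq (X : Type*) [TopologicalSpace X] :
    irrComps (Set.univ : Set X) = irreducibleComponents X := by
  rw [irreducibleComponents_eq_maximals_closed]
  ext C
  simp [irrComps, and_comm]

/-- A continuous self-map with dense range of a Noetherian space permutes the irreducible
components, through the closure of the image. -/
theorem DenseRange.image_irreducibleComponents {X : Type*} [TopologicalSpace X]
    [TopologicalSpace.NoetherianSpace X] {f : X → X} (hf : Continuous f) (hd : DenseRange f) :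
    (fun C => closure (f '' C)) '' irreducibleComponents X = irreducibleComponents X := by
  have hfin : (irreducibleComponents X).Finite :=
    TopologicalSpace.NoetherianSpace.finite_irreducibleComponents
  refine (Set.eq_of_subset_of_ncard_le ?_ (Set.ncard_image_le hfin) (hfin.image _)).symm
  intro D hD
  have hcover : D ⊆ ⋃ C ∈ irreducibleComponents X, closure (f '' C) := by
    rw [← hfin.closure_biUnion, ← Set.image_iUnion₂, ← Set.sUnion_eq_biUnion,
      sUnion_irreducibleComponents, Set.image_univ, hd.closure_range]
    exact Set.subset_univ D
  obtain ⟨C, hC, hDC⟩ := hD.1.exists_subset_of_subset_biUnion hfin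
    (fun _ _ => isClosed_closure) hcover
  exact ⟨C, hC, (hD.eq_of_subset (hC.1.image f hf.continuousOn).closure hDC).symm⟩

/-- **The cyclic structure of orbit closures** (from the proof of Theorem 1.7 of
Bell–Hu–Satriano): let `Z` be a non-empty Noetherian topological space, `Φ : Z → Z` a
continuous map, and `x ∈ Z` a point such that for every `n` the closure of
`{Φ^i(x) : i ≥ n}` is all of `Z`. Let `r` be the number of irreducible components of `Z`.
Then the irreducible components can be enumerated as `Z₀, …, Z_{r−1}` so that `x ∈ Z₀`,
`Φ(Z_i) ⊆ Z_{(i+1) mod r}` for all `i`, and the closure of `{Φ^{rn+i}(x) : n ∈ ℕ}` is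
`Z_i` for each `i`. -/
theorem cyclic_components_of_dense_orbit
    {Z : Type*} [TopologicalSpace Z] [TopologicalSpace.NoetherianSpace Z] [Nonempty Z]
    (Φ : Z → Z) (hΦ : Continuous Φ) (x : Z)
    (hdense : ∀ n : ℕ, closure {y : Z | ∃ i ≥ n, Φ^[i] x = y} = Set.univ)
    (r : ℕ) (hr : (irrComps (Set.univ : Set Z)).ncard = r) :
    ∃ Zc : ℕ → Set Z,
      (∀ i < r, Zc i ∈ irrComps (Set.univ : Set Z)) ∧
      (∀ i < r, ∀ j < r, Zc i = Zc j → i = j) ∧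
      (∀ C ∈ irrComps (Set.univ : Set Z), ∃ i < r, Zc i = C) ∧
      x ∈ Zc 0 ∧
      (∀ i < r, Φ '' Zc i ⊆ Zc ((i + 1) % r)) ∧
      (∀ i < r, closure {y : Z | ∃ n : ℕ, Φ^[r * n + i] x = y} = Zc i) := by
  rw [irrComps_univ_eq] at hr ⊢
  have hfin : (irreducibleComponents Z).Finite :=
    TopologicalSpace.NoetherianSpace.finite_irreducibleComponents
  have hd : DenseRange Φ := by
    refine dense_iff_closure_eq.2 (Set.eq_univ_of_univ_subset ((hdense 1).ge.trans
      (closure_mono ?_)))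
    rintro _ ⟨i, hi, rfl⟩
    obtain ⟨k, rfl⟩ := Nat.exists_eq_add_of_le' hi
    exact ⟨Φ^[k] x, (Function.iterate_succ_apply' Φ k x).symm⟩
  set F : Set Z → Set Z := fun C => closure (Φ '' C)
  have hFI : F '' irreducibleComponents Z = irreducibleComponents Z :=
    hd.image_irreducibleComponents hΦ
  set C₀ := irreducibleComponent x
  have hiter (n : ℕ) : F^[n] C₀ ∈ irreducibleComponents Z := by
    induction n with
    | zero => exact irreducibleComponent_mem_irreducibleComponents x
    | succ n ih =>
      rw [Function.iterate_succ_apply', ← hFI]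
      exact Set.mem_image_of_mem F ih
  have hmem (n : ℕ) : Φ^[n] x ∈ F^[n] C₀ := by
    induction n with
    | zero => exact mem_irreducibleComponent
    | succ n ih =>
      rw [Function.iterate_succ_apply', Function.iterate_succ_apply']
      exact subset_closure (Set.mem_image_of_mem Φ ih)
  have hclosed (n : ℕ) : IsClosed (F^[n] C₀) :=
    isClosed_of_mem_irreducibleComponents _ (hiter n)
  have htrans : ∀ C ∈ irreducibleComponents Z, ∃ n, F^[n] C₀ = C := by
    intro C hC
    have hrange : (Set.range fun n => F^[n] C₀).Finite :=
      hfin.subset (Set.range_subset_iff.2 hiter)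
    have hcl : IsClosed (⋃ D ∈ Set.range fun n => F^[n] C₀, D) :=
      hrange.isClosed_biUnion (by rintro _ ⟨n, rfl⟩; exact hclosed n)
    have hcover : C ⊆ ⋃ D ∈ Set.range fun n => F^[n] C₀, D := by
      refine (Set.subset_univ C).trans ((hdense 0).ge.trans (closure_minimal ?_ hcl))
      rintro _ ⟨n, -, rfl⟩
      exact Set.mem_biUnion (Set.mem_range_self n) (hmem n)
    obtain ⟨_, ⟨n, rfl⟩, hn⟩ := hC.1.exists_subset_of_subset_biUnion hrange
      (by rintro _ ⟨n, rfl⟩; exact hclosed n) hcover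
    exact ⟨n, (hC.eq_of_subset (hiter n).1 hn).symm⟩
  have hper : C₀ ∈ Function.periodicPts F := by
    obtain ⟨C, hC, hCC₀⟩ := hFI.ge (hiter 0)
    obtain ⟨n, rfl⟩ := htrans C hC
    exact ⟨n + 1, n.succ_pos, (Function.iterate_succ_apply' F n C₀).trans hCC₀⟩
  have hpos := Function.minimalPeriod_pos_of_mem_periodicPts hper
  have hinj := Function.iterate_injOn_Iio_minimalPeriod (f := F) (x := C₀)
  have himage : (fun n => F^[n] C₀) '' Set.Iio (Function.minimalPeriod F C₀) =
      irreducibleComponents Z := by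
    refine Set.Subset.antisymm (Set.image_subset_iff.2 fun n _ => hiter n) fun C hC => ?_
    obtain ⟨n, rfl⟩ := htrans C hC
    exact ⟨n % Function.minimalPeriod F C₀, Nat.mod_lt n hpos,
      Function.iterate_mod_minimalPeriod_eq⟩
  have hrp : Function.minimalPeriod F C₀ = r := by
    rw [← hr, ← himage, hinj.ncard_image]
    simp
  have hmod (n : ℕ) : F^[n % r] C₀ = F^[n] C₀ :=
    hrp ▸ Function.iterate_mod_minimalPeriod_eq
  rw [hrp] at hpos hinj himage
  refine ⟨fun n => F^[n] C₀, fun i _ => hiter i, fun i hi j hj h => hinj hi hj h,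
    fun C hC => himage.ge hC, mem_irreducibleComponent, fun i _ => ?_, fun i hi => ?_⟩
  · simp only [hmod, Function.iterate_succ_apply']
    exact subset_closure
  · set A : ℕ → Set Z := fun j => closure {y : Z | ∃ n : ℕ, Φ^[r * n + j] x = y}
    have hAsub {j : ℕ} (hj : j < r) : A j ⊆ F^[j] C₀ := by
      refine closure_minimal ?_ (hclosed j)
      rintro _ ⟨n, rfl⟩
      have h := hmem (r * n + j)
      rwa [← hmod, Nat.mul_add_mod, Nat.mod_eq_of_lt hj] at h
    have hcl : IsClosed (⋃ j ∈ Set.Iio r, A j) :=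
      (Set.finite_Iio r).isClosed_biUnion fun _ _ => isClosed_closure
    have hcover : F^[i] C₀ ⊆ ⋃ j ∈ Set.Iio r, A j := by
      refine (Set.subset_univ _).trans ((hdense 0).ge.trans (closure_minimal ?_ hcl))
      rintro _ ⟨n, -, rfl⟩
      exact Set.mem_biUnion (Set.mem_Iio.2 (Nat.mod_lt n hpos))
        (subset_closure ⟨n / r, by rw [Nat.div_add_mod]⟩)
    obtain ⟨j, hj, hij⟩ := (hiter i).1.exists_subset_of_subset_biUnion (Set.finite_Iio r)
      (fun _ _ => isClosed_closure) hcover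
    obtain rfl : i = j :=
      hinj hi hj ((hiter i).eq_of_subset (hiter j).1 (hij.trans (hAsub hj)))
    exact (hAsub hi).antisymm hij
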